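/- Let d ≥ 1, let β̄=(β_1,…,β_d) with 0<β_k<1/2 for each k, and let p be a real number satisfying 2p > 7/3 − β_k for every k. Then there exists a constant M>0 such that for every t̄=(t_1,…,t_d) ∈ ℝ^d, the sum ∑_{α=(α_1,…,α_d), α_k≥1} ∏_{k=1}^d (α_k+1)^{−2p} (∫_ℝ (t_k−u)₊^{β_k−1} ξ_{α_k}(u) du)² is finite and bounded by M. -/

import Mathlib

open MeasureTheory Set

/-- The `n`-th physicists' Hermite polynomial, as a function on ℝ, defined by the Rodrigues
formula `H_n(x) = (-1)^n e^{x²} (d/dx)^n e^{-x²}`. -/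
noncomputable def physHermite (n : ℕ) (x : ℝ) : ℝ :=
  (-1 : ℝ) ^ n * Real.exp (x ^ 2) * iteratedDeriv n (fun t : ℝ => Real.exp (-t ^ 2)) x

/-- The `n`-th Hermite function `ξ_n(x) = (2^n n! √π)^{-1/2} H_n(x) e^{-x²/2}`. -/
noncomputable def hermiteFun (n : ℕ) (x : ℝ) : ℝ :=
  ((2 : ℝ) ^ n * (n.factorial : ℝ) * Real.sqrt Real.pi) ^ (-(1 / 2) : ℝ) *
    physHermite n x * Real.exp (-x ^ 2 / 2)

open Polynomial in
/-- The `n`-th physicists' Hermite polynomial. -/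
noncomputable def physHermitePoly : ℕ → ℝ[X]
  | 0 => 1
  | n + 1 => 2 * X * physHermitePoly n - derivative (physHermitePoly n)

section GaussianWeight

open Polynomial

theorem derivative_physHermitePoly_succ (n : ℕ) :
    derivative (physHermitePoly (n + 1)) = 2 * ((n : ℝ[X]) + 1) * physHermitePoly n := by
  induction n with
  | zero => simp [physHermitePoly]
  | succ n ih =>
    rw [physHermitePoly, derivative_sub, derivative_mul, ih]
    have h : derivative (2 * ((n : ℝ[X]) + 1) * physHermitePoly n)
        = 2 * ((n : ℝ[X]) + 1) * derivative (physHermitePoly n) := by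
      simp [derivative_mul]
    rw [h]
    simp only [physHermitePoly, derivative_mul, derivative_X, derivative_ofNat]
    push_cast
    ring

theorem hasDerivAt_eval_mul_exp_neg_sq (q : ℝ[X]) (x : ℝ) :
    HasDerivAt (fun x => q.eval x * Real.exp (-x ^ 2))
      ((derivative q - 2 * X * q).eval x * Real.exp (-x ^ 2)) x := by
  have h1 : HasDerivAt (fun x : ℝ => Real.exp (-x ^ 2)) (Real.exp (-x ^ 2) * (-(2 * x))) x := by
    simpa using ((hasDerivAt_pow 2 x).neg).exp
  refine ((q.hasDerivAt x).mul h1).congr_deriv ?_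
  simp only [eval_sub, eval_mul, eval_X, eval_ofNat]
  ring

theorem integrable_eval_mul_exp_neg_sq (q : ℝ[X]) :
    Integrable (fun x => q.eval x * Real.exp (-x ^ 2)) := by
  induction q using Polynomial.induction_on' with
  | add p q hp hq =>
    simp only [eval_add, add_mul]
    exact hp.add hq
  | monomial n a =>
    have h := integrable_rpow_mul_exp_neg_mul_sq one_pos (s := n)
      (by linarith [n.cast_nonneg (α := ℝ)])
    simpa [mul_assoc] using h.const_mul a

theorem integral_eval_derivative_sub (q : ℝ[X]) :
    ∫ x, (derivative q - 2 * X * q).eval x * Real.exp (-x ^ 2) = 0 :=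
  integral_eq_zero_of_hasDerivAt_of_integrable (hasDerivAt_eval_mul_exp_neg_sq q)
    (integrable_eval_mul_exp_neg_sq _) (integrable_eval_mul_exp_neg_sq q)

theorem integral_physHermitePoly_sq (n : ℕ) :
    ∫ x, (physHermitePoly n ^ 2).eval x * Real.exp (-x ^ 2)
      = 2 ^ n * n.factorial * √Real.pi := by
  induction n with
  | zero => simpa [physHermitePoly] using integral_gaussian 1
  | succ n ih =>
    have h := integral_eval_derivative_sub (physHermitePoly (n + 1) * physHermitePoly n)
    have e : derivative (physHermitePoly (n + 1) * physHermitePoly n)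
          - 2 * X * (physHermitePoly (n + 1) * physHermitePoly n)
        = C (2 * ((n : ℝ) + 1)) * physHermitePoly n ^ 2 - physHermitePoly (n + 1) ^ 2 := by
      rw [derivative_mul, derivative_physHermitePoly_succ]
      simp only [physHermitePoly, C_mul, C_add, C_1, map_natCast, map_ofNat]
      ring
    rw [e] at h
    simp only [eval_sub, eval_mul, eval_C, sub_mul, mul_assoc] at h
    rw [integral_sub, integral_const_mul, integral_const_mul, ih, sub_eq_zero] at h
    · rw [← h, Nat.factorial_succ]
      push_cast
      ring
    · exact ((integrable_eval_mul_exp_neg_sq _).const_mul _).const_mul _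
    · exact integrable_eval_mul_exp_neg_sq _

theorem integral_derivative_physHermitePoly_sq (n : ℕ) :
    ∫ x, (derivative (physHermitePoly n) ^ 2).eval x * Real.exp (-x ^ 2)
      = 2 * n * (2 ^ n * n.factorial * √Real.pi) := by
  cases n with
  | zero => simp [physHermitePoly]
  | succ n =>
    have e : derivative (physHermitePoly (n + 1)) ^ 2
        = C (4 * ((n : ℝ) + 1) ^ 2) * physHermitePoly n ^ 2 := by
      rw [derivative_physHermitePoly_succ]
      simp only [C_mul, C_add, C_1, map_natCast, map_ofNat, C_pow]
      ring
    rw [e]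
    simp only [eval_mul, eval_C, mul_assoc]
    rw [integral_const_mul, integral_const_mul, integral_physHermitePoly_sq, Nat.factorial_succ]
    push_cast
    ring

theorem eval_physHermitePoly_sq_mul_exp_neg_sq_le (n : ℕ) (x : ℝ) :
    (physHermitePoly n ^ 2).eval x * Real.exp (-x ^ 2)
      ≤ 2 * √(2 * n + 1) * (2 ^ n * n.factorial * √Real.pi) := by
  set P := physHermitePoly n with hP
  set P' := derivative P with hP'
  set R := physHermitePoly (n + 1) with hR
  set N : ℝ := 2 ^ n * n.factorial * √Real.pi with hN
  set a : ℝ := √(2 * n + 1) with ha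
  have ha0 : 0 < a := Real.sqrt_pos.2 (by positivity)
  have ha2 : a ^ 2 = 2 * n + 1 := Real.sq_sqrt (by positivity)
  set D := derivative (P ^ 2) - 2 * X * P ^ 2 with hD
  set E := C a * P ^ 2 + C (1 / (2 * a)) * (P' ^ 2 + R ^ 2) with hE
  have key : ∀ y, D.eval y ≤ E.eval y := by
    intro y
    have e1 : D.eval y = P.eval y * (P'.eval y - R.eval y) := by
      have : D = P * (P' - R) := by
        rw [hD, hR, physHermitePoly, ← hP, ← hP', sq, derivative_mul, ← hP']
        ring
      rw [this]; simp
    have e2 : E.eval y - P.eval y * (P'.eval y - R.eval y)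
        = ((2 * a * P.eval y - (P'.eval y - R.eval y)) ^ 2
            + (P'.eval y + R.eval y) ^ 2) / (4 * a) := by
      simp only [hE, eval_add, eval_mul, eval_C, eval_pow]
      field_simp
      ring
    have : 0 ≤ ((2 * a * P.eval y - (P'.eval y - R.eval y)) ^ 2
            + (P'.eval y + R.eval y) ^ 2) / (4 * a) := by positivity
    linarith
  have hE0 : ∀ y, 0 ≤ E.eval y := by
    intro y
    simp only [hE, eval_add, eval_mul, eval_C, eval_pow]
    positivity
  have hlim := tendsto_zero_of_hasDerivAt_of_integrableOn_Iic (a := x)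
    (fun y _ => hasDerivAt_eval_mul_exp_neg_sq (P ^ 2) y)
    (integrable_eval_mul_exp_neg_sq _).integrableOn
    (integrable_eval_mul_exp_neg_sq _).integrableOn
  have hftc := integral_Iic_of_hasDerivAt_of_tendsto' (a := x)
    (fun y _ => hasDerivAt_eval_mul_exp_neg_sq (P ^ 2) y)
    (integrable_eval_mul_exp_neg_sq _).integrableOn hlim
  rw [sub_zero] at hftc
  rw [← hftc]
  have hN2 : ∫ y, (R ^ 2).eval y * Real.exp (-y ^ 2) = 2 * (n + 1) * N := by
    rw [hR, integral_physHermitePoly_sq, Nat.factorial_succ]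
    push_cast
    ring
  have hI : ∫ y, E.eval y * Real.exp (-y ^ 2) = 2 * a * N := by
    have e : (fun y => E.eval y * Real.exp (-y ^ 2)) = fun y =>
        a * ((P ^ 2).eval y * Real.exp (-y ^ 2))
        + 1 / (2 * a) * ((P' ^ 2).eval y * Real.exp (-y ^ 2)
          + (R ^ 2).eval y * Real.exp (-y ^ 2)) := by
      ext y
      simp only [hE, eval_add, eval_mul, eval_C]
      ring
    rw [e, integral_add, integral_const_mul, integral_const_mul, integral_add, hN2,
      integral_derivative_physHermitePoly_sq, integral_physHermitePoly_sq]
    · field_simp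
      rw [ha2]
      ring
    · exact integrable_eval_mul_exp_neg_sq _
    · exact integrable_eval_mul_exp_neg_sq _
    · exact (integrable_eval_mul_exp_neg_sq _).const_mul _
    · exact ((integrable_eval_mul_exp_neg_sq _).add (integrable_eval_mul_exp_neg_sq _)).const_mul _
  calc _ ≤ ∫ y in Iic x, E.eval y * Real.exp (-y ^ 2) :=
        setIntegral_mono (integrable_eval_mul_exp_neg_sq _).integrableOn
          (integrable_eval_mul_exp_neg_sq _).integrableOn
          fun y => mul_le_mul_of_nonneg_right (key y) (Real.exp_pos _).le
    _ ≤ ∫ y, E.eval y * Real.exp (-y ^ 2) :=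
        setIntegral_le_integral (integrable_eval_mul_exp_neg_sq _)
          (Filter.Eventually.of_forall fun y => mul_nonneg (hE0 y) (Real.exp_pos _).le)
    _ = _ := hI

theorem iteratedDeriv_exp_neg_sq (n : ℕ) :
    iteratedDeriv n (fun t : ℝ => Real.exp (-t ^ 2))
      = fun x => ((-1) ^ n * physHermitePoly n).eval x * Real.exp (-x ^ 2) := by
  induction n with
  | zero => simp [physHermitePoly]
  | succ n ih =>
    rw [iteratedDeriv_succ, ih]
    ext x
    rw [(hasDerivAt_eval_mul_exp_neg_sq _ x).deriv]
    have : derivative ((-1 : ℝ[X]) ^ n) = 0 := by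
      rw [show (-1 : ℝ[X]) ^ n = C ((-1) ^ n) by simp, derivative_C]
    rw [derivative_mul, this, physHermitePoly]
    congr 2
    ring

theorem physHermite_eq_eval (n : ℕ) (x : ℝ) : physHermite n x = (physHermitePoly n).eval x := by
  have h1 : ((-1 : ℝ) ^ n) * (-1) ^ n = 1 := by rw [← mul_pow]; simp
  have h2 : Real.exp (x ^ 2) * Real.exp (-x ^ 2) = 1 := by rw [← Real.exp_add]; simp
  rw [physHermite, iteratedDeriv_exp_neg_sq]
  simp only [eval_mul, eval_pow, eval_neg, eval_one]
  linear_combination (physHermitePoly n).eval x * Real.exp (x ^ 2) * Real.exp (-x ^ 2) * h1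
    + (physHermitePoly n).eval x * h2

end GaussianWeight

theorem hermiteFun_sq (n : ℕ) (x : ℝ) :
    hermiteFun n x ^ 2 = ((2 : ℝ) ^ n * n.factorial * √Real.pi)⁻¹ *
      ((physHermitePoly n ^ 2).eval x * Real.exp (-x ^ 2)) := by
  have h1 : (((2 : ℝ) ^ n * n.factorial * √Real.pi) ^ (-(1 / 2) : ℝ)) ^ 2
      = ((2 : ℝ) ^ n * n.factorial * √Real.pi)⁻¹ := by
    rw [← Real.rpow_natCast, ← Real.rpow_mul (by positivity), ← Real.rpow_neg_one]
    norm_num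
  have h2 : Real.exp (-x ^ 2 / 2) ^ 2 = Real.exp (-x ^ 2) := by
    rw [← Real.exp_nat_mul]
    congr 1
    push_cast
    ring
  rw [hermiteFun, mul_pow, mul_pow, h1, h2, physHermite_eq_eval, Polynomial.eval_pow, mul_assoc]

theorem integrable_hermiteFun_sq (n : ℕ) : Integrable (fun x => hermiteFun n x ^ 2) := by
  simp only [hermiteFun_sq]
  exact (integrable_eval_mul_exp_neg_sq _).const_mul _

theorem integral_hermiteFun_sq (n : ℕ) : ∫ x, hermiteFun n x ^ 2 = 1 := by
  simp only [hermiteFun_sq]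
  rw [integral_const_mul, integral_physHermitePoly_sq]
  exact inv_mul_cancel₀ (by positivity)

theorem hermiteFun_sq_le (n : ℕ) (x : ℝ) : hermiteFun n x ^ 2 ≤ 2 * √(2 * n + 1) := by
  rw [hermiteFun_sq, inv_mul_le_iff₀ (by positivity), mul_comm _ (2 * _)]
  exact eval_physHermitePoly_sq_mul_exp_neg_sq_le n x

/-- Hermite coefficients of the fractional kernel grow at most like `n ^ (1 / 4)`, uniformly in
the translation parameter. -/
theorem exists_integral_fractional_mul_hermiteFun_sq_le {b : ℝ} (hb : 0 < b) (hb' : b < 1 / 2) :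
    ∃ c : ℝ, 0 < c ∧ ∀ (n : ℕ) (t : ℝ),
      (∫ u : ℝ, max (t - u) 0 ^ (b - 1) * hermiteFun n u) ^ 2 ≤ c * √((n : ℝ) + 1) := by
  set near : ℝ → ℝ := (Ioc 0 1).indicator fun v => v ^ (b - 1) with hnear
  set far : ℝ → ℝ := (Ioi 1).indicator fun v => v ^ (2 * b - 2) with hfar
  have near_int : Integrable near := by
    rw [hnear, integrable_indicator_iff measurableSet_Ioc,
      ← intervalIntegrable_iff_integrableOn_Ioc_of_le zero_le_one]
    exact intervalIntegral.intervalIntegrable_rpow' (by linarith)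
  have far_int : Integrable far := by
    rw [hfar, integrable_indicator_iff measurableSet_Ioi]
    exact integrableOn_Ioi_rpow_of_lt (by linarith) one_pos
  set A := ∫ v, near v
  set A' := ∫ v, far v
  have bound : ∀ (n : ℕ) (t u : ℝ), ‖max (t - u) 0 ^ (b - 1) * hermiteFun n u‖ ≤
      √(2 * √(2 * n + 1)) * near (t - u) + (far (t - u) + hermiteFun n u ^ 2) / 2 := by
    intro n t u
    have hB : |hermiteFun n u| ≤ √(2 * √(2 * n + 1)) := Real.abs_le_sqrt (hermiteFun_sq_le n u)
    rw [norm_mul, Real.norm_eq_abs, Real.norm_eq_abs]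
    generalize t - u = v
    rcases le_or_gt v 0 with hv | hv
    · have h1 : near v = 0 := indicator_of_notMem (fun h => absurd h.1 (not_lt.2 hv)) _
      have h2 : far v = 0 :=
        indicator_of_notMem (fun h => absurd (mem_Ioi.1 h) (by linarith)) _
      rw [max_eq_right hv, Real.zero_rpow (by linarith), h1, h2, abs_zero]
      simp only [zero_mul, mul_zero, zero_add]
      positivity
    rw [max_eq_left hv.le, abs_of_nonneg (Real.rpow_nonneg hv.le _)]
    rcases le_or_gt v 1 with hv1 | hv1
    · have h1 : near v = v ^ (b - 1) := indicator_of_mem (mem_Ioc.2 ⟨hv, hv1⟩) _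
      have h2 : far v = 0 := indicator_of_notMem (fun h => absurd (mem_Ioi.1 h) (not_lt.2 hv1)) _
      rw [h1, h2]
      have := mul_le_mul_of_nonneg_left hB (Real.rpow_nonneg hv.le (b - 1))
      nlinarith [sq_nonneg (hermiteFun n u)]
    · have h1 : near v = 0 := indicator_of_notMem (fun h => absurd h.2 (not_le.2 hv1)) _
      have h2 : far v = (v ^ (b - 1)) ^ 2 := by
        rw [hfar, indicator_of_mem (mem_Ioi.2 hv1), ← Real.rpow_natCast, ← Real.rpow_mul hv.le]
        congr 1
        push_cast
        ring
      rw [h1, h2, ← sq_abs (hermiteFun n u)]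
      nlinarith [sq_nonneg (v ^ (b - 1) - |hermiteFun n u|)]
  have hA : ∀ (n : ℕ) (t : ℝ), |∫ u : ℝ, max (t - u) 0 ^ (b - 1) * hermiteFun n u|
      ≤ √(2 * √(2 * n + 1)) * A + (A' + 1) / 2 := by
    intro n t
    have i1 : Integrable (fun u => √(2 * √(2 * n + 1)) * near (t - u)) :=
      (near_int.comp_sub_left t).const_mul _
    have i2 : Integrable (fun u => (far (t - u) + hermiteFun n u ^ 2) / 2) :=
      ((far_int.comp_sub_left t).add (integrable_hermiteFun_sq n)).div_const 2
    refine (norm_integral_le_of_norm_le (i1.add i2)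
      (Filter.Eventually.of_forall (bound n t))).trans_eq ?_
    simp only [Pi.add_apply]
    rw [integral_add i1 i2, integral_const_mul, integral_div,
      integral_add (far_int.comp_sub_left t) (integrable_hermiteFun_sq n),
      integral_sub_left_eq_self near, integral_sub_left_eq_self far, integral_hermiteFun_sq]
  refine ⟨8 * A ^ 2 + 2 * ((A' + 1) / 2) ^ 2 + 1, by positivity, fun n t => ?_⟩
  have hs : 1 ≤ √((n : ℝ) + 1) := Real.one_le_sqrt.2 (by simp)
  have hs2 : √(2 * (n : ℝ) + 1) ≤ 2 * √((n : ℝ) + 1) := by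
    rw [Real.sqrt_le_left (by positivity), mul_pow, Real.sq_sqrt (by positivity)]
    linarith [n.cast_nonneg (α := ℝ)]
  have hB2 : √(2 * √(2 * (n : ℝ) + 1)) ^ 2 = 2 * √(2 * (n : ℝ) + 1) :=
    Real.sq_sqrt (by positivity)
  rw [← sq_abs]
  calc _ ≤ (√(2 * √(2 * n + 1)) * A + (A' + 1) / 2) ^ 2 :=
        pow_le_pow_left₀ (abs_nonneg _) (hA n t) 2
    _ ≤ 2 * (√(2 * √(2 * n + 1)) ^ 2 * A ^ 2) + 2 * ((A' + 1) / 2) ^ 2 := by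
        nlinarith [sq_nonneg (√(2 * √(2 * n + 1)) * A - (A' + 1) / 2)]
    _ ≤ _ := by
        rw [hB2]
        nlinarith [mul_le_mul_of_nonneg_right hs2 (sq_nonneg A),
          mul_le_mul_of_nonneg_left hs (sq_nonneg ((A' + 1) / 2))]

/-- A sum over a finite product of types of a product of nonnegative functions is summable, with
sum at most the product of bounds of the sums of the factors. -/
theorem summable_prod_and_tsum_prod_le {ι κ : Type*} [Fintype ι] {f : ι → κ → ℝ} {M : ι → ℝ}
    (hf : ∀ i a, 0 ≤ f i a) (hM : ∀ i (s : Finset κ), ∑ a ∈ s, f i a ≤ M i) :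
    Summable (fun α : ι → κ => ∏ i, f i (α i)) ∧ ∑' α : ι → κ, ∏ i, f i (α i) ≤ ∏ i, M i := by
  classical
  have h0 : 0 ≤ fun α : ι → κ => ∏ i, f i (α i) := fun α => Finset.prod_nonneg fun i _ => hf i _
  have h1 : ∀ u : Finset (ι → κ), ∑ α ∈ u, ∏ i, f i (α i) ≤ ∏ i, M i := by
    intro u
    calc _ ≤ ∑ α ∈ Fintype.piFinset fun i => u.image fun α => α i, ∏ i, f i (α i) :=
          Finset.sum_le_sum_of_subset_of_nonneg
            (fun α hα => Fintype.mem_piFinset.2 fun i => Finset.mem_image_of_mem _ hα)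
            fun α _ _ => h0 α
      _ = ∏ i, ∑ a ∈ u.image fun α => α i, f i a := (Finset.prod_univ_sum _ _).symm
      _ ≤ _ := Finset.prod_le_prod (fun i _ => Finset.sum_nonneg fun a _ => hf i a)
          fun i _ => hM i _
  exact ⟨summable_of_sum_le h0 h1, Real.tsum_le_of_sum_le h0 h1⟩

/-- **Uniform finiteness of the weighted sum of squared Hermite coefficients of the
anisotropic fractional kernel.** For `d ≥ 1`, `β̄ = (β_1,…,β_d)` with `0 < β_k < 1/2`, and
`p` with `2p > 7/3 - β_k` for each `k`, there is `M > 0` such that for every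
`t̄ ∈ ℝ^d` the sum
`∑_{α, α_k ≥ 1} ∏_k (α_k+1)^{-2p} (∫ (t_k-u)₊^{β_k-1} ξ_{α_k}(u) du)²`
is finite and bounded by `M`. -/
theorem hermite_coefficient_sum_bounded
    (d : ℕ) (hd : 1 ≤ d) (β : Fin d → ℝ) (hβ : ∀ k, 0 < β k ∧ β k < 1 / 2)
    (p : ℝ) (hp : ∀ k, 7 / 3 - β k < 2 * p) :
    ∃ M : ℝ, 0 < M ∧ ∀ t : Fin d → ℝ,
      Summable (fun α : Fin d → ℕ+ =>
        ∏ k, (((α k : ℕ) : ℝ) + 1) ^ (-(2 * p)) *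
          (∫ u : ℝ, max (t k - u) 0 ^ (β k - 1) * hermiteFun (α k) u) ^ 2) ∧
      ∑' α : Fin d → ℕ+,
        ∏ k, (((α k : ℕ) : ℝ) + 1) ^ (-(2 * p)) *
          (∫ u : ℝ, max (t k - u) 0 ^ (β k - 1) * hermiteFun (α k) u) ^ 2 ≤ M := by
  have key : ∀ k, ∃ M : ℝ, 0 ≤ M ∧ ∀ (t : ℝ) (s : Finset ℕ+),
      ∑ a ∈ s, (((a : ℕ) : ℝ) + 1) ^ (-(2 * p)) *
        (∫ u : ℝ, max (t - u) 0 ^ (β k - 1) * hermiteFun a u) ^ 2 ≤ M := by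
    intro k
    obtain ⟨c, hc, hcb⟩ := exists_integral_fractional_mul_hermiteFun_sq_le (hβ k).1 (hβ k).2
    have hsum : Summable fun n : ℕ => ((n : ℝ) + 1) ^ (-(2 * p)) * (c * √((n : ℝ) + 1)) := by
      have h := (Real.summable_one_div_nat_add_rpow 1 (2 * p - 1 / 2)).2
        (by linarith [hp k, (hβ k).2])
      refine (h.mul_left c).congr fun n => ?_
      have hn : (0 : ℝ) < n + 1 := by positivity
      rw [abs_of_pos hn, one_div, ← Real.rpow_neg hn.le, Real.sqrt_eq_rpow, mul_left_comm,
        ← Real.rpow_add hn]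
      congr 2
      ring
    have hsum' := hsum.comp_injective PNat.coe_injective
    refine ⟨_, tsum_nonneg fun a => ?_, fun t s => (Finset.sum_le_sum fun a _ => ?_).trans
      (hsum'.sum_le_tsum s fun a _ => ?_)⟩
    · simp only [Function.comp_apply]
      positivity
    · exact mul_le_mul_of_nonneg_left (hcb a t) (by positivity)
    · simp only [Function.comp_apply]
      positivity
  choose M hM0 hM using key
  refine ⟨∏ k, M k + 1, by linarith [Finset.prod_nonneg fun k (_ : k ∈ Finset.univ) => hM0 k],
    fun t => ?_⟩
  obtain ⟨h1, h2⟩ := summable_prod_and_tsum_prod_le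
    (f := fun k (a : ℕ+) => (((a : ℕ) : ℝ) + 1) ^ (-(2 * p)) *
      (∫ u : ℝ, max (t k - u) 0 ^ (β k - 1) * hermiteFun a u) ^ 2)
    (fun k a => by positivity) (fun k s => hM k (t k) s)
  exact ⟨h1, h2.trans (by linarith)⟩
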